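/- Let D be a noncommutative division ring, algebraic over its center F, and suppose D contains a maximal subfield K that is algebraic of bounded degree over F. Then D contains a noncommutative division subring that is finite-dimensional over F. -/

import Mathlib

lemma lin_solve {D : Type*} [DivisionRing D] {ι κ : Type*} [Fintype ι] [Fintype κ]
    (h : Fintype.card κ < Fintype.card ι) (A : ι → κ → D) :
    ∃ y : ι → D, y ≠ 0 ∧ ∀ i, ∑ j, y j * A j i = 0 := by
  let f : (ι → D) →ₗ[D] (κ → D) :=
    { toFun := fun y i => ∑ j, y j * A j i
      map_add' := by
        intro x y; ext i; simp [add_mul, Finset.sum_add_distrib]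
      map_smul' := by
        intro c y; ext i; simp [mul_assoc, Finset.mul_sum] }
  have hf : LinearMap.ker f ≠ ⊥ := LinearMap.ker_ne_bot_of_finrank_lt (by simpa using h)
  obtain ⟨y, hy, hy0⟩ := (Submodule.ne_bot_iff _).1 hf
  refine ⟨y, hy0, fun i => ?_⟩
  exact congrFun (LinearMap.mem_ker.1 hy) i

lemma lin_solve_right {D : Type*} [DivisionRing D] {ι κ : Type*} [Fintype ι] [Fintype κ]
    (h : Fintype.card κ < Fintype.card ι) (A : ι → κ → D) :
    ∃ y : ι → D, y ≠ 0 ∧ ∀ i, ∑ j, A j i * y j = 0 := by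
  obtain ⟨y, hy0, hy⟩ := lin_solve (D := Dᵐᵒᵖ) h (fun j i => MulOpposite.op (A j i))
  refine ⟨fun j => (y j).unop, fun h0 => hy0 ?_, fun i => ?_⟩
  · ext j
    simpa using congrFun h0 j
  · have := congrArg MulOpposite.unop (hy i)
    simpa using this

lemma trick {D : Type*} [DivisionRing D] {ι : Type*} [Fintype ι]
    (V : Set (ι → D)) (S : Set D)
    (hsub : ∀ y ∈ V, ∀ z ∈ V, y - z ∈ V)
    (hl : ∀ d : D, ∀ y ∈ V, (fun j => d * y j) ∈ V)
    (hr : ∀ s ∈ S, ∀ y ∈ V, (fun j => y j * s) ∈ V)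
    (hne : ∃ y ∈ V, y ≠ 0) :
    ∃ y ∈ V, y ≠ 0 ∧ ∀ j, ∀ s ∈ S, y j * s = s * y j := by
  classical
  let P : ℕ → Prop := fun k => ∃ y ∈ V, y ≠ 0 ∧ (Finset.univ.filter (fun j => y j ≠ 0)).card = k
  have hP : ∃ k, P k := by
    obtain ⟨y, hy, h0⟩ := hne
    exact ⟨_, y, hy, h0, rfl⟩
  obtain ⟨y, hy, hy0, hk⟩ := Nat.find_spec hP
  obtain ⟨j0, hj0⟩ := Function.ne_iff.1 hy0
  simp only [Pi.zero_apply] at hj0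
  let z : ι → D := fun j => (y j0)⁻¹ * y j
  have hz : z ∈ V := hl _ _ hy
  have hz1 : z j0 = 1 := by simp [z, hj0]
  refine ⟨z, hz, fun h => by simp [h] at hz1, ?_⟩
  intro j s hs
  let w : ι → D := (fun j => z j * s) - (fun j => s * z j)
  have hw : w ∈ V := hsub _ (hr s hs _ hz) _ (hl s _ hz)
  by_contra hne'
  have hw0 : w ≠ 0 := by
    intro h
    apply hne'
    have := congrFun h j
    simpa [w, sub_eq_zero] using this
  have hlt : (Finset.univ.filter (fun j => w j ≠ 0)).card < Nat.find hP := by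
    rw [← hk]
    apply Finset.card_lt_card
    rw [Finset.ssubset_iff_of_subset]
    · exact ⟨j0, by simp [hj0], by simp [w, hz1]⟩
    · intro i hi
      simp only [Finset.mem_filter, Finset.mem_univ, true_and] at hi ⊢
      intro h
      apply hi
      simp [w, z, h]
  exact Nat.find_min hP hlt ⟨w, hw, hw0, rfl⟩

lemma trick_right {D : Type*} [DivisionRing D] {ι : Type*} [Fintype ι]
    (V : Set (ι → D)) (S : Set D)
    (hsub : ∀ y ∈ V, ∀ z ∈ V, y - z ∈ V)
    (hl : ∀ d : D, ∀ y ∈ V, (fun j => y j * d) ∈ V)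
    (hr : ∀ s ∈ S, ∀ y ∈ V, (fun j => s * y j) ∈ V)
    (hne : ∃ y ∈ V, y ≠ 0) :
    ∃ y ∈ V, y ≠ 0 ∧ ∀ j, ∀ s ∈ S, y j * s = s * y j := by
  obtain ⟨y, hy, hy0, h⟩ := trick (D := Dᵐᵒᵖ) {y : ι → Dᵐᵒᵖ | (fun j => (y j).unop) ∈ V}
    {s | s.unop ∈ S}
    (fun y hy z hz => hsub _ hy _ hz)
    (fun d y hy => hl d.unop _ hy) (fun s hs y hy => hr _ hs _ hy)
    (by
      obtain ⟨y, hy, hy0⟩ := hne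
      refine ⟨fun j => MulOpposite.op (y j), hy, fun h0 => hy0 ?_⟩
      ext j
      simpa using congrFun h0 j)
  refine ⟨_, hy, fun h0 => hy0 ?_, fun j s hs => ?_⟩
  · ext j
    simpa using congrFun h0 j
  · have := congrArg MulOpposite.unop (h j (MulOpposite.op s) (by simpa using hs))
    simpa using this.symm

/-- From `[L:F] < ∞` and `C_D(L) = K` conclude that `D` is finite dimensional. -/
lemma finite_of_centralizer {F K D : Type*} [Field F] [Field K] [DivisionRing D] [Algebra F K]
    [Algebra F D] (ι : K →ₐ[F] D)
    (hcen : ∀ d : D, (∀ x, d * x = x * d) → ∃ c : F, algebraMap F D c = d)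
    (L : IntermediateField F K) [FiniteDimensional F L]
    (hL : ∀ d : D, (∀ l ∈ L, d * ι l = ι l * d) → ∃ k, ι k = d) : Module.Finite F D := by
  classical
  let _ : Module K D := Module.compHom D ι.toRingHom
  have hsm : ∀ (k : K) (d : D), k • d = ι k * d := fun k d => rfl
  have : IsScalarTower F K D := ⟨fun a k d => by simp [hsm]⟩
  let m := Module.finrank F L
  let e := Module.finBasis F L
  have h1 : Module.rank K D ≤ m := by
    apply rank_le
    intro s hs
    by_contra hlt
    push Not at hlt
    obtain ⟨y, hy0, hy⟩ := lin_solve (ι := s) (κ := Fin m) (by simpa using hlt)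
      (fun j i => ι (e i) * (j : D))
    have hall : ∀ l : L, ∑ j : s, y j * (ι l * (j : D)) = 0 := by
      intro l
      rw [← e.sum_repr l]
      simp only [IntermediateField.coe_sum, map_sum, Finset.sum_mul, Finset.mul_sum,
        IntermediateField.coe_smul, map_smul, smul_mul_assoc, mul_smul_comm]
      rw [Finset.sum_comm]
      apply Finset.sum_eq_zero
      intro i _
      rw [← Finset.smul_sum, hy i, smul_zero]
    obtain ⟨z, hz, hz0, hzc⟩ := trick (ι := s)
      {y | ∀ l : L, ∑ j : s, y j * (ι l * (j : D)) = 0} {d | ∃ l ∈ L, ι l = d}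
      (fun y hy z hz l => by
        simp only [Pi.sub_apply, sub_mul, Finset.sum_sub_distrib]
        rw [hy l, hz l, sub_zero])
      (fun d y hy l => by
        simp only [mul_assoc, ← Finset.mul_sum]
        rw [hy l, mul_zero])
      (by
        rintro _ ⟨l', hl', rfl⟩ y hy l
        have := hy (⟨l', hl'⟩ * l)
        simpa [mul_assoc] using this)
      ⟨y, hall, hy0⟩
    have hzk : ∀ j, ∃ k, ι k = z j := fun j => hL _ fun l hl => hzc j _ ⟨l, hl, rfl⟩
    choose k hk using hzk
    have := Fintype.linearIndependent_iff.1 hs k (by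
      have := hz 1
      simpa [hsm, hk] using this)
    apply hz0
    ext j
    rw [← hk, this j]; simp
  have : Module.Finite K D := by
    apply Module.rank_lt_aleph0_iff.1
    exact h1.trans_lt Cardinal.natCast_lt_aleph0
  let t := Module.finrank K D
  let b := Module.finBasis K D
  have h2 : Module.rank F K ≤ t := by
    apply rank_le
    intro s hs
    by_contra hlt
    push Not at hlt
    obtain ⟨y, hy0, hy⟩ := lin_solve_right (ι := s) (κ := Fin t) (by simpa using hlt)
      (fun j i => ι (j : K) * b i)
    have hall : ∀ x : D, ∑ j : s, ι (j : K) * x * y j = 0 := by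
      intro x
      rw [← b.sum_repr x]
      simp only [Finset.sum_mul, Finset.mul_sum, hsm]
      rw [Finset.sum_comm]
      apply Finset.sum_eq_zero
      intro i _
      have : ∀ j : s, ι (j : K) * (ι (b.repr x i) * b i) * y j
          = ι (b.repr x i) * (ι (j : K) * b i * y j) := by
        intro j
        rw [← mul_assoc, ← map_mul, mul_comm (j : K), map_mul]
        simp only [mul_assoc]
      simp only [this]
      rw [← Finset.mul_sum, hy i, mul_zero]
    obtain ⟨z, hz, hz0, hzc⟩ := trick_right (ι := s)
      {y | ∀ x : D, ∑ j : s, ι (j : K) * x * y j = 0} Set.univ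
      (fun y hy z hz l => by
        simp only [Pi.sub_apply, mul_sub, Finset.sum_sub_distrib]
        rw [hy l, hz l, sub_zero])
      (fun d y hy l => by
        simp only [← mul_assoc, ← Finset.sum_mul]
        rw [hy l, zero_mul])
      (by
        rintro d - y hy l
        have := hy (l * d)
        simpa [mul_assoc] using this)
      ⟨y, hall, hy0⟩
    have hzk : ∀ j, ∃ k, algebraMap F D k = z j := fun j => hcen _ fun l => hzc j _ trivial
    choose k hk using hzk
    have := Fintype.linearIndependent_iff.1 hs k (by
      apply ι.injective
      have := hz 1
      simp only [← hk] at this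
      simp only [map_sum, map_smul, map_zero, Algebra.smul_def]
      rw [← this]
      apply Finset.sum_congr rfl
      intro j _
      rw [mul_one, Algebra.commutes]
      exact (map_mul ι _ _).trans (by rw [ι.commutes]))
    apply hz0
    ext j
    rw [← hk, this j]; simp
  have : Module.Finite F K := by
    apply Module.rank_lt_aleph0_iff.1
    exact h2.trans_lt Cardinal.natCast_lt_aleph0
  exact Module.Finite.trans K D

/-- Separable closure in a bounded degree extension is finite. -/
lemma finite_sep {F K : Type*} [Field F] [Field K] [Algebra F K] [Algebra.IsSeparable F K] (n : ℕ)
    (hb : ∀ k : K, (minpoly F k).natDegree ≤ n) : FiniteDimensional F K := by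
  classical
  let P : ℕ → Prop := fun d => ∃ k : K, (minpoly F k).natDegree = d
  have hP0 : ∃ d ≤ n, P d := ⟨_, hb 0, 0, rfl⟩
  obtain ⟨d0, hd0, hPd0⟩ := hP0
  obtain ⟨α, hα⟩ : P (Nat.findGreatest P n) := Nat.findGreatest_spec hd0 hPd0
  have hmax : ∀ k : K, (minpoly F k).natDegree ≤ (minpoly F α).natDegree := fun k => by
    rw [hα]; exact Nat.le_findGreatest (hb k) ⟨k, rfl⟩
  have hint : ∀ k : K, IsIntegral F k := Algebra.IsSeparable.isIntegral F
  have htop : (IntermediateField.adjoin F {α}) = ⊤ := by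
    rw [eq_top_iff]
    intro β _
    have : FiniteDimensional F (IntermediateField.adjoin F {α, β}) := by
      apply IntermediateField.finiteDimensional_adjoin
      intro x _
      exact hint x
    obtain ⟨γ, hγ⟩ := Field.exists_primitive_element F (IntermediateField.adjoin F {α, β})
    have h1 : Module.finrank F (IntermediateField.adjoin F {α, β}) ≤
        Module.finrank F (IntermediateField.adjoin F {α}) := by
      rw [IntermediateField.adjoin.finrank (hint α), ← IntermediateField.finrank_top',
        ← hγ, IntermediateField.adjoin.finrank (IsIntegral.of_finite F γ)]
      have := hmax γ
      rwa [← minpoly.algebraMap_eq (A := F) (B := IntermediateField.adjoin F {α, β}) (B' := K)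
        Subtype.val_injective γ]
    have h2 := IntermediateField.eq_of_le_of_finrank_le
      (IntermediateField.adjoin.mono F {α} {α, β} (by simp)) h1
    rw [h2]
    exact IntermediateField.subset_adjoin _ _ (by simp)
  have := IntermediateField.adjoin.finiteDimensional (hint α)
  rw [htop] at this
  exact Module.Finite.equiv (IntermediateField.topEquiv (F := F) (E := K)).toLinearEquiv

lemma main_abs {F K D : Type*} [Field F] [Field K] [DivisionRing D] [Algebra F K]
    [Algebra F D] (ι : K →ₐ[F] D)
    (hcen : ∀ d : D, (∀ x, d * x = x * d) → ∃ c : F, algebraMap F D c = d)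
    (hmax : ∀ d : D, (∀ k, d * ι k = ι k * d) → ∃ k, ι k = d)
    (halg : ∀ k : K, IsAlgebraic F k)
    (n : ℕ) (hb : ∀ k : K, (minpoly F k).natDegree ≤ n) :
    Module.Finite F D ∨ ∃ a c : D, a * c - c * a = 1 := by
  classical
  have : Algebra.IsAlgebraic F K := ⟨halg⟩
  let L := separableClosure F K
  have : FiniteDimensional F L := by
    apply finite_sep n
    intro k
    have := hb k
    rwa [← minpoly.algebraMap_eq (A := F) (B := L) (B' := K) Subtype.val_injective k]
  by_cases hZ : ∀ d : D, (∀ l ∈ L, d * ι l = ι l * d) → ∃ k, ι k = d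
  · exact Or.inl (finite_of_centralizer ι hcen L hZ)
  right
  -- an element `y` of the centralizer of `L` and `a ∈ K` not commuting
  push Not at hZ
  obtain ⟨y, hyL, hyK⟩ := hZ
  obtain ⟨k, hk⟩ : ∃ k, y * ι k ≠ ι k * y := by
    by_contra h
    push Not at h
    obtain ⟨k, hk⟩ := hmax y h
    exact hyK k hk
  let q := ringExpChar F
  have : ExpChar F q := inferInstance
  have : ExpChar L q := expChar_of_injective_algebraMap (algebraMap F L).injective q
  obtain ⟨e, he⟩ := IsPurelyInseparable.pow_mem L q k
  have hex : ∃ e, y * ι (k ^ q ^ e) = ι (k ^ q ^ e) * y := by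
    obtain ⟨l, hl⟩ := he
    exact ⟨e, by rw [← hl]; exact hyL _ l.2⟩
  let e0 := Nat.find hex
  have he0 : y * ι (k ^ q ^ e0) = ι (k ^ q ^ e0) * y := Nat.find_spec hex
  have hpos : e0 ≠ 0 := by
    intro h
    rw [h] at he0
    apply hk
    simpa using he0
  obtain ⟨e1, he1⟩ := Nat.exists_eq_succ_of_ne_zero hpos
  have hlt : y * ι (k ^ q ^ e1) ≠ ι (k ^ q ^ e1) * y :=
    Nat.find_min hex (show e1 < e0 by omega)
  let a : D := ι (k ^ q ^ e1)
  have haq : a ^ q * y = y * a ^ q := by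
    rw [he1, pow_succ, pow_mul, map_pow] at he0
    exact he0.symm
  have : ExpChar (Module.End F D) q :=
    expChar_of_injective_algebraMap (algebraMap F (Module.End F D)).injective q
  let δ : Module.End F D := LinearMap.mulLeft F a - LinearMap.mulRight F a
  have hδ : ∀ x, δ x = a * x - x * a := fun x => rfl
  have hδq : (δ ^ q) y = 0 := by
    rw [show δ ^ q = _ from sub_pow_expChar_of_commute q (LinearMap.commute_mulLeft_right a a)]
    rw [LinearMap.pow_mulLeft, LinearMap.pow_mulRight]
    simp [haq]
  have hex2 : ∃ r, (δ ^ r) y = 0 := ⟨q, hδq⟩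
  let r := Nat.find hex2
  have hr : (δ ^ r) y = 0 := Nat.find_spec hex2
  have hδy : δ y ≠ 0 := by
    rw [hδ, sub_ne_zero]
    exact hlt.symm
  have hr2 : 2 ≤ r := by
    by_contra h
    have h' : r = 0 ∨ r = 1 := by omega
    rcases h' with h' | h'
    · rw [h'] at hr
      apply hδy
      have : y = 0 := by simpa using hr
      simp [this]
    · rw [h'] at hr
      exact hδy (by simpa using hr)
  obtain ⟨t, ht⟩ := Nat.exists_eq_add_of_le' hr2
  let w := (δ ^ t) y
  have hw1 : δ w ≠ 0 := by
    have := Nat.find_min hex2 (show t + 1 < r by omega)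
    rwa [pow_succ'] at this
  have hw2 : δ (δ w) = 0 := by
    rw [ht, pow_succ', pow_succ'] at hr
    exact hr
  set u := δ w with hu
  have hau : a * u = u * a := by
    rw [hδ] at hw2
    exact sub_eq_zero.1 hw2
  have hau' : a * u⁻¹ = u⁻¹ * a := (Commute.inv_right₀ (show Commute a u from hau)).eq
  refine ⟨a, u⁻¹ * w, ?_⟩
  rw [← mul_assoc, hau', mul_assoc, mul_assoc, ← mul_sub, ← hδ, ← hu]
  exact inv_mul_cancel₀ hw1

lemma weyl_finite {F D : Type*} [Field F] [DivisionRing D] [Algebra F D] (a c : D)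
    (ha : IsIntegral F a) (hc : IsIntegral F c) (h : a * c - c * a = 1) :
    ∃ S : Submodule F D, S.FG ∧ ∀ x ∈ Algebra.adjoin F {a, c}, x ∈ S := by
  let A := Algebra.adjoin F {a}
  let C := Algebra.adjoin F {c}
  let S : Submodule F D := Subalgebra.toSubmodule A * Subalgebra.toSubmodule C
  have hder : ∀ x ∈ A, x * c - c * x ∈ A := by
    intro x hx
    induction hx using Algebra.adjoin_induction with
    | mem x hx =>
      rw [Set.mem_singleton_iff.1 hx, h]; exact one_mem _
    | algebraMap r => rw [Algebra.commutes, sub_self]; exact zero_mem _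
    | add x y _ _ hx hy =>
      have : (x + y) * c - c * (x + y) = (x * c - c * x) + (y * c - c * y) := by noncomm_ring
      rw [this]; exact add_mem hx hy
    | mul x y hx' hy' hx hy =>
      have : (x * y) * c - c * (x * y) = x * (y * c - c * y) + (x * c - c * x) * y := by
        noncomm_ring
      rw [this]; exact add_mem (mul_mem hx' hy) (mul_mem hx hy')
  have hS : ∀ x ∈ Algebra.adjoin F {a, c}, ∀ s ∈ S, x * s ∈ S := by
    intro x hx
    induction hx using Algebra.adjoin_induction with
    | mem x hx =>
      intro s hs
      induction hs using Submodule.mul_induction_on' with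
      | mem_mul_mem p hp r hr =>
        rcases hx with rfl | hx
        · rw [← mul_assoc]
          exact Submodule.mul_mem_mul (mul_mem (S := Subalgebra F D) (s := A)
            (Algebra.subset_adjoin rfl) hp) hr
        · rw [Set.mem_singleton_iff.1 hx]
          have : c * (p * r) = p * (c * r) - (p * c - c * p) * r := by noncomm_ring
          rw [this]
          refine sub_mem (Submodule.mul_mem_mul hp (mul_mem (S := Subalgebra F D) (s := C)
            (Algebra.subset_adjoin rfl) hr)) (Submodule.mul_mem_mul (hder p hp) hr)
      | add p _ r _ hp hr => rw [mul_add]; exact add_mem hp hr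
    | algebraMap r => intro s hs; rw [← Algebra.smul_def]; exact S.smul_mem _ hs
    | add x y _ _ hx hy => intro s hs; rw [add_mul]; exact add_mem (hx s hs) (hy s hs)
    | mul x y _ _ hx hy => intro s hs; rw [mul_assoc]; exact hx _ (hy s hs)
  refine ⟨S, ha.fg_adjoin_singleton.mul hc.fg_adjoin_singleton, fun x hx => ?_⟩
  have h1 : (1 : D) ∈ S := by
    have := Submodule.mul_mem_mul (M := Subalgebra.toSubmodule A) (N := Subalgebra.toSubmodule C)
      (m := 1) (n := 1) (one_mem A) (one_mem C)
    simpa using this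
  simpa using hS x hx 1 h1

theorem stmt15 {D : Type*} [DivisionRing D]
    (hnc : ∃ a b : D, a * b ≠ b * a)
    (halg : ∀ a : D, IsAlgebraic (Subring.center D) a)
    (K : Subfield D)
    (hcomm : ∀ x ∈ K, ∀ y ∈ K, x * y = y * x)
    (hmax : ∀ d : D, (∀ x ∈ K, d * x = x * d) → d ∈ K)
    (n : ℕ) (hbdd : ∀ a ∈ K, (minpoly (Subring.center D) a).natDegree ≤ n) :
    ∃ E : Subfield D, (∃ a b : D, a ∈ E ∧ b ∈ E ∧ a * b ≠ b * a) ∧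
      ∃ s : Finset D,
        (E : Set D) ⊆ (Submodule.span (Subring.center D) (s : Set D) : Set D) := by
  let K' : Subalgebra (Subring.center D) D :=
    { K.toSubring with
      algebraMap_mem' := fun r => hmax _ fun x _ => (Subring.mem_center_iff.1 r.2 x).symm }
  let _ : Field K' :=
    { (inferInstance : Ring K') with
      mul_comm := fun x y => Subtype.ext (hcomm _ x.2 _ y.2)
      inv := fun x => ⟨(x : D)⁻¹, K.inv_mem x.2⟩
      exists_pair_ne := ⟨0, 1, fun h => zero_ne_one (congrArg Subtype.val h : (0 : D) = 1)⟩
      mul_inv_cancel := fun x hx => Subtype.ext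
        (mul_inv_cancel₀ (fun h => hx (Subtype.ext h)))
      inv_zero := Subtype.ext inv_zero
      nnqsmul := _
      nnqsmul_def := fun _ _ => rfl
      qsmul := _
      qsmul_def := fun _ _ => rfl }
  have hinj : Function.Injective K'.val := Subtype.val_injective
  have key := main_abs (F := Subring.center D) (K := K') (D := D) K'.val
    (fun d hd => ⟨⟨d, Subring.mem_center_iff.2 fun x => (hd x).symm⟩, rfl⟩)
    (fun d hd => ⟨⟨d, hmax d fun x hx => hd ⟨x, hx⟩⟩, rfl⟩)
    (fun k => (isAlgebraic_algHom_iff K'.val hinj).1 (halg k))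
    n (fun k => by
      rw [← minpoly.algHom_eq K'.val hinj k]
      exact hbdd k k.2)
  rcases key with hfin | ⟨a, c, hac⟩
  · obtain ⟨a, b, hab⟩ := hnc
    obtain ⟨s, hs⟩ := hfin.fg_top
    exact ⟨⊤, ⟨a, b, trivial, trivial, hab⟩, s, fun x _ => by rw [hs]; trivial⟩
  · obtain ⟨S, ⟨s, hs⟩, hmem⟩ := weyl_finite (F := Subring.center D) a c
      (halg a).isIntegral (halg c).isIntegral hac
    let E : Subfield D :=
      { (Algebra.adjoin (Subring.center D) {a, c}).toSubring with
        inv_mem' := fun x hx => IsIntegral.inv_mem (halg x).isIntegral hx }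
    refine ⟨E, ⟨a, c, Algebra.subset_adjoin (by simp), Algebra.subset_adjoin (by simp), ?_⟩, s, ?_⟩
    · intro h
      rw [h, sub_self] at hac
      exact zero_ne_one hac
    · intro x hx
      rw [hs]
      exact hmem x hx
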